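/- Let d ≥ 2, let μ be the Haar probability measure on U(d), let O be a d×d Hermitian matrix, and let ρ be a d×d complex matrix that is a pure-state density matrix, i.e. ρ is positive semidefinite with Tr[ρ] = 1 and ρ² = ρ. Then ∫ (Tr[O V ρ V†])² dμ(V) = ((Tr[O])² + Tr[O²])/(d² − 1) · (1 − 1/d). -/

import Mathlib

open MeasureTheory Matrix
open scoped Kronecker ComplexOrder

noncomputable section

attribute [local instance] Matrix.frobeniusNormedAddCommGroup Matrix.frobeniusNormedSpace

local instance {n m : Type*} [Fintype n] [Fintype m] : MeasurableSpace (Matrix n m ℂ) :=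
  borel _

local instance {n m : Type*} [Fintype n] [Fintype m] : BorelSpace (Matrix n m ℂ) := ⟨rfl⟩

/-- The Frobenius (Hilbert–Schmidt) norm `‖M‖₂ = √Tr[M† M]`. -/
def frobNorm {n : Type*} [Fintype n] (M : Matrix n n ℂ) : ℝ :=
  Real.sqrt (Matrix.trace (star M * M)).re

/-- The conjugated state `V ρ V†`. -/
def conjSt {d : ℕ} (ρ : Matrix (Fin d) (Fin d) ℂ) (V : Matrix.unitaryGroup (Fin d) ℂ) :
    Matrix (Fin d) (Fin d) ℂ := V.1 * ρ * star V.1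

theorem conjSt_mul {d : ℕ} (ρ : Matrix (Fin d) (Fin d) ℂ) (U V : Matrix.unitaryGroup (Fin d) ℂ) :
    conjSt ρ (U * V) = U.1 * conjSt ρ V * star U.1 := by
  simp [conjSt, Matrix.mul_assoc]

theorem conjSt_inv {d : ℕ} (μ : Measure (Matrix.unitaryGroup (Fin d) ℂ)) [μ.IsHaarMeasure]
    (ρ : Matrix (Fin d) (Fin d) ℂ) (g : Matrix (Fin d) (Fin d) ℂ → ℂ)
    (U : Matrix (Fin d) (Fin d) ℂ) (hU : U * star U = 1) :
    ∫ V, g (U * conjSt ρ V * star U) ∂μ = ∫ V, g (conjSt ρ V) ∂μ := by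
  have hU' : U ∈ Matrix.unitaryGroup (Fin d) ℂ := Matrix.mem_unitaryGroup_iff.2 hU
  rw [← integral_mul_left_eq_self (fun V => g (conjSt ρ V)) (⟨U, hU'⟩ : Matrix.unitaryGroup (Fin d) ℂ)]
  simp only [conjSt_mul]

theorem conjSt_cont {d : ℕ} (ρ : Matrix (Fin d) (Fin d) ℂ) (i j : Fin d) :
    Continuous (fun V => conjSt ρ V i j) := by
  have h : Continuous (fun V => conjSt ρ V) := by
    unfold conjSt
    exact (continuous_subtype_val.mul continuous_const).mul continuous_subtype_val.star
  exact h.matrix_elem i j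

theorem conjSt_bound {d : ℕ} (ρ : Matrix (Fin d) (Fin d) ℂ) (i j : Fin d)
    (V : Matrix.unitaryGroup (Fin d) ℂ) :
    ‖conjSt ρ V i j‖ ≤ ∑ b, ∑ a, ‖ρ a b‖ := by
  simp only [conjSt, Matrix.mul_apply, Finset.sum_mul]
  refine (norm_sum_le _ _).trans (Finset.sum_le_sum fun b _ => ?_)
  refine (norm_sum_le _ _).trans (Finset.sum_le_sum fun a _ => ?_)
  have h1 := entry_norm_bound_of_unitary V.2 i a
  have h2 := entry_norm_bound_of_unitary V.2 j b
  rw [norm_mul, norm_mul, Matrix.star_apply, norm_star]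
  calc _ ≤ 1 * ‖ρ a b‖ * 1 := by gcongr
    _ = _ := by ring

theorem conjSt_integrable {d : ℕ} (μ : Measure (Matrix.unitaryGroup (Fin d) ℂ))
    [IsProbabilityMeasure μ] (ρ : Matrix (Fin d) (Fin d) ℂ) (i j k l : Fin d) :
    Integrable (fun V => conjSt ρ V i j * conjSt ρ V k l) μ := by
  refine Integrable.of_bound
    ((conjSt_cont ρ i j).mul (conjSt_cont ρ k l)).measurable.aestronglyMeasurable
    ((∑ b, ∑ a, ‖ρ a b‖) * (∑ b, ∑ a, ‖ρ a b‖)) (ae_of_all _ fun V => ?_)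
  rw [norm_mul]
  have h1 := conjSt_bound ρ i j V
  have h2 := conjSt_bound ρ k l V
  gcongr

/-- Second moments of entries. -/
def mom {d : ℕ} (μ : Measure (Matrix.unitaryGroup (Fin d) ℂ)) (ρ : Matrix (Fin d) (Fin d) ℂ)
    (i j k l : Fin d) : ℂ := ∫ V, conjSt ρ V i j * conjSt ρ V k l ∂μ

section
variable {d : ℕ} (μ : Measure (Matrix.unitaryGroup (Fin d) ℂ))
    [μ.IsHaarMeasure] [IsProbabilityMeasure μ] (ρ : Matrix (Fin d) (Fin d) ℂ)

/-- The matrix permuting coordinates. -/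
def pm (σ : Equiv.Perm (Fin d)) : Matrix (Fin d) (Fin d) ℂ := (1 : Matrix _ _ ℂ).submatrix σ id

theorem pm_mul (σ : Equiv.Perm (Fin d)) (M : Matrix (Fin d) (Fin d) ℂ) (i j : Fin d) :
    (pm σ * M) i j = M (σ i) j := by
  simp [pm, Matrix.mul_apply, Matrix.one_apply]

theorem mul_star_pm (σ : Equiv.Perm (Fin d)) (M : Matrix (Fin d) (Fin d) ℂ) (i j : Fin d) :
    (M * star (pm σ)) i j = M i (σ j) := by
  simp [pm, Matrix.mul_apply, Matrix.star_apply, Matrix.one_apply, apply_ite]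

theorem pm_unitary (σ : Equiv.Perm (Fin d)) : pm σ * star (pm σ) = 1 := by
  ext i j
  rw [mul_star_pm]
  simp [pm, Matrix.one_apply]

theorem mom_perm (σ : Equiv.Perm (Fin d)) (i j k l : Fin d) :
    mom μ ρ (σ i) (σ j) (σ k) (σ l) = mom μ ρ i j k l := by
  have h := conjSt_inv μ ρ (fun P => P i j * P k l) (pm σ) (pm_unitary σ)
  simp only [mul_star_pm, pm_mul] at h
  exact h

theorem exists_perm_pair {i j k l : Fin d} (h : i ≠ j) (h' : k ≠ l) :
    ∃ σ : Equiv.Perm (Fin d), σ i = k ∧ σ j = l := by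
  refine ⟨Equiv.swap (Equiv.swap i k j) l * Equiv.swap i k, ?_, ?_⟩
  · simp only [Equiv.Perm.mul_apply, Equiv.swap_apply_left]
    apply Equiv.swap_apply_of_ne_of_ne _ h'
    intro hk
    have : Equiv.swap i k i = Equiv.swap i k j := by simpa using hk
    exact h ((Equiv.swap i k).injective this)
  · simp

theorem mom_diag (i j : Fin d) : mom μ ρ i i i i = mom μ ρ j j j j := by
  have := mom_perm μ ρ (Equiv.swap i j) i i i i
  simpa using this.symm

theorem mom_off {i j k l : Fin d} (h : i ≠ j) (h' : k ≠ l) :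
    mom μ ρ k k l l = mom μ ρ i i j j ∧ mom μ ρ k l l k = mom μ ρ i j j i := by
  obtain ⟨σ, rfl, rfl⟩ := exists_perm_pair h h'
  exact ⟨mom_perm μ ρ σ i i j j, mom_perm μ ρ σ i j j i⟩

theorem integral_comb (x y : ℂ) (i j k l : Fin d) :
    ∫ V, (x * conjSt ρ V i j + y * conjSt ρ V k l) ^ 2 ∂μ
      = x ^ 2 * mom μ ρ i j i j + 2 * x * y * mom μ ρ i j k l + y ^ 2 * mom μ ρ k l k l := by
  have e : ∀ V, (x * conjSt ρ V i j + y * conjSt ρ V k l) ^ 2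
      = x ^ 2 * (conjSt ρ V i j * conjSt ρ V i j)
        + 2 * x * y * (conjSt ρ V i j * conjSt ρ V k l)
        + y ^ 2 * (conjSt ρ V k l * conjSt ρ V k l) := fun V => by ring
  simp only [e]
  have I1 := (conjSt_integrable μ ρ i j i j).const_mul (x ^ 2)
  have I2 := (conjSt_integrable μ ρ i j k l).const_mul (2 * x * y)
  have I3 := (conjSt_integrable μ ρ k l k l).const_mul (y ^ 2)
  refine (integral_add (I1.add I2) I3).trans ?_
  have h12 := integral_add I1 I2
  simp only [integral_const_mul] at h12 ⊢
  exact congrArg (· + y ^ 2 * mom μ ρ k l k l) h12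

theorem mom_phase {i j : Fin d} (h : i ≠ j) :
    mom μ ρ i j i j = - mom μ ρ i j i j := by
  have hU : (diagonal (fun k : Fin d => if k = i then Complex.I else 1)) *
      star (diagonal (fun k : Fin d => if k = i then Complex.I else 1)) = 1 := by
    rw [Matrix.star_eq_conjTranspose, Matrix.diagonal_conjTranspose, Matrix.diagonal_mul_diagonal,
      ← Matrix.diagonal_one]
    congr 1
    ext k
    by_cases hk : k = i <;> simp [hk]
  have := conjSt_inv μ ρ (fun P => P i j * P i j) _ hU
  rw [Matrix.star_eq_conjTranspose, Matrix.diagonal_conjTranspose] at this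
  simp only [Matrix.mul_diagonal, Matrix.diagonal_mul, Pi.star_apply, if_true, if_neg h.symm,
    star_one, mul_one] at this
  have e : ∀ V, Complex.I * conjSt ρ V i j * (Complex.I * conjSt ρ V i j)
      = - (conjSt ρ V i j * conjSt ρ V i j) := fun V => by
    linear_combination (conjSt ρ V i j * conjSt ρ V i j) * Complex.I_mul_I
  simp only [e, integral_neg] at this
  exact this.symm

theorem mom_rel {i j : Fin d} (h : i ≠ j) :
    mom μ ρ i i i i = mom μ ρ i i j j + mom μ ρ i j j i := by
  set w : ℂ := (1 - Complex.I) / 2 with hw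
  set w' : ℂ := (1 + Complex.I) / 2 with hw'
  have sw : star w = w' := by
    simp [hw, hw', Complex.ext_iff]
  have sw' : star w' = w := by
    simp [hw, hw', Complex.ext_iff]
  have I2 := Complex.I_mul_I
  have q1 : w * w' = 1 / 2 := by rw [hw, hw']; linear_combination (-1/4) * I2
  have q2 : w * w = - Complex.I / 2 := by rw [hw]; linear_combination (1/4) * I2
  have q3 : w' * w' = Complex.I / 2 := by rw [hw']; linear_combination (1/4) * I2
  have hS : star (pm (Equiv.swap i j)) = pm (Equiv.swap i j) := by
    have h1 : pm (Equiv.swap i j) * pm (Equiv.swap i j) = (1 : Matrix (Fin d) (Fin d) ℂ) := by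
      ext a b
      rw [pm_mul]
      simp [pm, Matrix.one_apply]
    calc _ = (pm (Equiv.swap i j) * pm (Equiv.swap i j)) * star (pm (Equiv.swap i j)) := by
          rw [h1, one_mul]
      _ = _ := by rw [mul_assoc, pm_unitary, mul_one]
  have hS2 := pm_unitary (Equiv.swap i j)
  have hstar : star (w' • 1 + w • pm (Equiv.swap i j) : Matrix (Fin d) (Fin d) ℂ)
      = w • 1 + w' • star (pm (Equiv.swap i j)) := by
    rw [star_add, star_smul, star_smul, sw, sw', star_one]
  have hU : (w' • 1 + w • pm (Equiv.swap i j) : Matrix (Fin d) (Fin d) ℂ) *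
      star (w' • 1 + w • pm (Equiv.swap i j) : Matrix (Fin d) (Fin d) ℂ) = 1 := by
    rw [hstar]
    simp only [add_mul, mul_add, smul_mul_smul, hS2, one_mul, mul_one]
    rw [hS, mul_comm w' w, q1, q2, q3]
    module
  have key := conjSt_inv μ ρ (fun P => (1 * P i i + (-1) * P j j) ^ 2) _ hU
  have e : ∀ P : Matrix (Fin d) (Fin d) ℂ, ∀ a : Fin d,
      ((w' • 1 + w • pm (Equiv.swap i j)) * P *
        star (w' • 1 + w • pm (Equiv.swap i j))) a a
      = (1 / 2) * P a a + (Complex.I / 2) * P a (Equiv.swap i j a)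
        - (Complex.I / 2) * P (Equiv.swap i j a) a
        + (1 / 2) * P (Equiv.swap i j a) (Equiv.swap i j a) := by
    intro P a
    rw [hstar]
    simp only [add_mul, mul_add, Matrix.smul_mul, Matrix.mul_smul, one_mul, mul_one,
      Matrix.add_apply, Matrix.smul_apply, mul_star_pm, pm_mul, smul_eq_mul]
    linear_combination (P a a + P (Equiv.swap i j a) (Equiv.swap i j a)) * q1
      + P a (Equiv.swap i j a) * q3 + P (Equiv.swap i j a) a * q2
  simp only [e, Equiv.swap_apply_left, Equiv.swap_apply_right] at key
  have e2 : ∀ V, (1 * ((1 / 2) * conjSt ρ V i i + (Complex.I / 2) * conjSt ρ V i j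
        - (Complex.I / 2) * conjSt ρ V j i + (1 / 2) * conjSt ρ V j j)
      + (-1) * ((1 / 2) * conjSt ρ V j j + (Complex.I / 2) * conjSt ρ V j i
        - (Complex.I / 2) * conjSt ρ V i j + (1 / 2) * conjSt ρ V i i)) ^ 2
      = (Complex.I * conjSt ρ V i j + (-Complex.I) * conjSt ρ V j i) ^ 2 := fun V => by ring
  simp only [e2] at key
  rw [integral_comb, integral_comb] at key
  have p1 := mom_phase μ ρ h
  have p2 := mom_phase μ ρ h.symm
  have p3 := mom_diag μ ρ j i
  have I2' : Complex.I ^ 2 = -1 := Complex.I_sq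
  linear_combination (-1/2) * key - p1 / 4 - p2 / 4 - p3 / 2
    + (mom μ ρ i j i j / 2 + mom μ ρ j i j i / 2 - mom μ ρ i j j i) * I2'

end

/-- The Haar second moment of the cost function: for `d ≥ 2`, a Hermitian observable `O`
and a pure-state density matrix `ρ`,
`∫ (Tr[O V ρ V†])² dμ(V) = ((Tr[O])² + Tr[O²])/(d² − 1) · (1 − 1/d)`. -/
theorem haar_second_moment_cost (d : ℕ) (hd : 2 ≤ d)
    (μ : Measure (Matrix.unitaryGroup (Fin d) ℂ))
    [μ.IsHaarMeasure] [IsProbabilityMeasure μ]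
    (O : Matrix (Fin d) (Fin d) ℂ) (hO : O.IsHermitian)
    (ρ : Matrix (Fin d) (Fin d) ℂ) (hρ : ρ.PosSemidef)
    (hρ1 : ρ.trace = 1) (hρ2 : ρ * ρ = ρ) :
    ∫ V : Matrix.unitaryGroup (Fin d) ℂ, ((O * (V.1 * ρ * star V.1)).trace) ^ 2 ∂μ
      = ((O.trace) ^ 2 + (O * O).trace) / ((d : ℂ) ^ 2 - 1) * (1 - 1 / (d : ℂ)) := by
  have hd0 : (d : ℂ) ≠ 0 := by
    exact_mod_cast (by omega : d ≠ 0)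
  have hd1 : (d : ℂ) - 1 ≠ 0 := by
    rw [sub_ne_zero]; exact_mod_cast (by omega : d ≠ 1)
  have hd2 : (d : ℂ) + 1 ≠ 0 := by
    exact_mod_cast (by omega : d + 1 ≠ 0)
  let i0 : Fin d := ⟨0, by omega⟩
  let i1 : Fin d := ⟨1, by omega⟩
  have h01 : i0 ≠ i1 := by simp [i0, i1]
  set a := mom μ ρ i0 i0 i0 i0 with ha
  set b := mom μ ρ i0 i0 i1 i1 with hb
  set c := mom μ ρ i0 i1 i1 i0 with hc
  have hB : ∀ i j, mom μ ρ i i j j = b + if i = j then a - b else 0 := by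
    intro i j
    by_cases h : i = j
    · subst h; rw [mom_diag μ ρ i i0]; simp [ha]
    · rw [(mom_off μ ρ h01 h).1]; simp [h, hb]
  have hC : ∀ i j, mom μ ρ i j j i = c + if i = j then a - c else 0 := by
    intro i j
    by_cases h : i = j
    · subst h; rw [mom_diag μ ρ i i0]; simp [ha]
    · rw [(mom_off μ ρ h01 h).2]; simp [h, hc]
  have hrel : a = b + c := mom_rel μ ρ h01
  have hstarV : ∀ V : Matrix.unitaryGroup (Fin d) ℂ, star V.1 * V.1 = 1 := fun V =>
    Matrix.mem_unitaryGroup_iff'.1 V.2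
  have htr : ∀ V, (conjSt ρ V).trace = 1 := fun V => by
    rw [conjSt, Matrix.trace_mul_comm, ← mul_assoc, hstarV, one_mul, hρ1]
  have hsq : ∀ V, (conjSt ρ V * conjSt ρ V).trace = 1 := fun V => by
    have : conjSt ρ V * conjSt ρ V = conjSt ρ V := by
      calc _ = V.1 * ρ * (star V.1 * V.1) * ρ * star V.1 := by simp only [conjSt, mul_assoc]
        _ = V.1 * (ρ * ρ) * star V.1 := by rw [hstarV, mul_one]; simp only [mul_assoc]
        _ = _ := by rw [hρ2, conjSt]
    rw [this, htr]
  have s1 : ∑ i, ∑ j, mom μ ρ i i j j = 1 := by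
    have e : ∫ V, ∑ i, ∑ j, conjSt ρ V i i * conjSt ρ V j j ∂μ = 1 := by
      have : ∀ V, ∑ i, ∑ j, conjSt ρ V i i * conjSt ρ V j j = 1 := fun V => by
        rw [← Finset.sum_mul_sum]
        have := htr V
        simp only [Matrix.trace, Matrix.diag] at this
        rw [this, one_mul]
      simp [this]
    rw [← e, integral_finsetSum _ fun i _ => integrable_finsetSum _ fun j _ =>
      conjSt_integrable μ ρ i i j j]
    refine Finset.sum_congr rfl fun i _ => ?_
    rw [integral_finsetSum _ fun j _ => conjSt_integrable μ ρ i i j j]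
    rfl
  have s2 : ∑ i, ∑ j, mom μ ρ i j j i = 1 := by
    have e : ∫ V, ∑ i, ∑ j, conjSt ρ V i j * conjSt ρ V j i ∂μ = 1 := by
      have : ∀ V, ∑ i, ∑ j, conjSt ρ V i j * conjSt ρ V j i = 1 := fun V => by
        have := hsq V
        simpa only [Matrix.trace, Matrix.diag, Matrix.mul_apply] using this
      simp [this]
    rw [← e, integral_finsetSum _ fun i _ => integrable_finsetSum _ fun j _ =>
      conjSt_integrable μ ρ i j j i]
    refine Finset.sum_congr rfl fun i _ => ?_
    rw [integral_finsetSum _ fun j _ => conjSt_integrable μ ρ i j j i]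
    rfl
  simp only [hB, Finset.sum_add_distrib, Finset.sum_ite_eq, Finset.mem_univ, if_true,
    Finset.sum_const, Finset.card_univ, Fintype.card_fin, nsmul_eq_mul] at s1
  simp only [hC, Finset.sum_add_distrib, Finset.sum_ite_eq, Finset.mem_univ, if_true,
    Finset.sum_const, Finset.card_univ, Fintype.card_fin, nsmul_eq_mul] at s2
  have hbc : b = c := by
    have : (d : ℂ) * ((d : ℂ) - 1) * (b - c) = 0 := by linear_combination s1 - s2
    have := (mul_eq_zero.1 this).resolve_left (mul_ne_zero hd0 hd1)
    exact sub_eq_zero.1 this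
  have hab : a = 2 * b := by rw [hrel, ← hbc]; ring
  have hbv : (d : ℂ) * ((d : ℂ) + 1) * b = 1 := by
    rw [hab] at s1; linear_combination s1
  -- diagonalise the observable
  set U : Matrix (Fin d) (Fin d) ℂ := hO.eigenvectorUnitary.1 with hUdef
  set ev : Fin d → ℂ := fun i => (hO.eigenvalues i : ℂ) with hev
  have hUU : star U * U = 1 := hstarV hO.eigenvectorUnitary
  have hUU' : U * star U = 1 := Matrix.mem_unitaryGroup_iff.1 hO.eigenvectorUnitary.2
  have hOd : O = U * diagonal ev * star U := by
    have := hO.spectral_theorem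
    rw [Unitary.conjStarAlgAut_apply] at this
    exact this
  have t1 : O.trace = ∑ i, ev i := by
    rw [hOd, Matrix.trace_mul_comm, ← mul_assoc, hUU, one_mul, Matrix.trace_diagonal]
  have t2 : (O * O).trace = ∑ i, ev i * ev i := by
    have : O * O = U * (diagonal ev * diagonal ev) * star U := by
      calc _ = U * diagonal ev * (star U * U) * diagonal ev * star U := by
            rw [hOd]; simp only [mul_assoc]
        _ = _ := by rw [hUU, mul_one]; simp only [mul_assoc]
    rw [this, Matrix.trace_mul_comm, ← mul_assoc, hUU, one_mul, Matrix.diagonal_mul_diagonal,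
      Matrix.trace_diagonal]
  have main : ∫ V : Matrix.unitaryGroup (Fin d) ℂ, ((O * (V.1 * ρ * star V.1)).trace) ^ 2 ∂μ
      = ∑ i, ∑ j, ev i * ev j * mom μ ρ i i j j := by
    have h := conjSt_inv μ ρ (fun P => ((O * P).trace) ^ 2) U hUU'
    have e : ∀ V, ((O * (U * conjSt ρ V * star U)).trace) ^ 2
        = ∑ i, ∑ j, ev i * ev j * (conjSt ρ V i i * conjSt ρ V j j) := fun V => by
      have : (O * (U * conjSt ρ V * star U)).trace = ∑ i, ev i * conjSt ρ V i i := by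
        have h1 : O * (U * conjSt ρ V * star U)
            = U * (diagonal ev * conjSt ρ V) * star U := by
          calc _ = U * diagonal ev * (star U * U) * conjSt ρ V * star U := by
                rw [hOd]; simp only [mul_assoc]
            _ = _ := by rw [hUU, mul_one]; simp only [mul_assoc]
        rw [h1, Matrix.trace_mul_comm, ← mul_assoc, hUU, one_mul]
        simp [Matrix.trace, Matrix.diagonal_mul]
      rw [this, sq, Finset.sum_mul_sum]
      refine Finset.sum_congr rfl fun i _ => Finset.sum_congr rfl fun j _ => ?_
      ring
    simp only [e] at h
    refine h.symm.trans ?_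
    rw [integral_finsetSum _ fun i _ => integrable_finsetSum _ fun j _ =>
      (conjSt_integrable μ ρ i i j j).const_mul _]
    refine Finset.sum_congr rfl fun i _ => ?_
    rw [integral_finsetSum _ fun j _ => (conjSt_integrable μ ρ i i j j).const_mul _]
    refine Finset.sum_congr rfl fun j _ => ?_
    rw [integral_const_mul]
    rfl
  have s3 : ∑ i, ∑ j, ev i * ev j * mom μ ρ i i j j
      = b * ((∑ i, ev i) ^ 2 + ∑ i, ev i * ev i) := by
    rw [sq, Finset.sum_mul_sum, mul_add, Finset.mul_sum, Finset.mul_sum, ← Finset.sum_add_distrib]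
    refine Finset.sum_congr rfl fun i _ => ?_
    simp only [hB, hab, mul_add, Finset.sum_add_distrib, mul_ite, mul_zero, Finset.sum_ite_eq,
      Finset.mem_univ, if_true, Finset.mul_sum]
    congr 1
    · exact Finset.sum_congr rfl fun j _ => by ring
    · ring
  rw [main, s3, ← t1, ← t2]
  have hbv' : b = 1 / ((d : ℂ) * ((d : ℂ) + 1)) := by
    rw [eq_div_iff (mul_ne_zero hd0 hd2)]; linear_combination hbv
  have hd3 : (d : ℂ) ^ 2 - 1 ≠ 0 := by
    have : (d : ℂ) ^ 2 - 1 = ((d : ℂ) - 1) * ((d : ℂ) + 1) := by ring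
    rw [this]; exact mul_ne_zero hd1 hd2
  rw [hbv']
  field_simp
  ring
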